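/- Let g be a finite-dimensional Lie algebra over a field of characteristic zero with nondegenerate Killing form κ, and let s ⊆ g be a subalgebra that is semisimple (as an abstract Lie algebra). Then the restriction of κ to the centraliser C = z_g(s) = {x ∈ g ∣ [x,s] = 0} is nondegenerate. -/

import Mathlib

open LinearMap.BilinForm in
/-- The Casimir element of an ideal on which the trace form is nondegenerate is an endomorphism of
the module which commutes with the action of the whole algebra, has trace the dimension of the ideal
and has range spanned by brackets. -/
theorem LieModule.exists_commute_trace_eq_finrank {K L M : Type*} [Field K]
    [LieRing L] [LieAlgebra K L] [FiniteDimensional K L]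
    [AddCommGroup M] [Module K M] [LieRingModule L M] [LieModule K L M]
    (I : LieIdeal K L)
    (hI : LinearMap.BilinForm.Nondegenerate (traceForm K I M)) :
    ∃ Ω : Module.End K M, (∀ x : L, Commute (toEnd K L M x) Ω) ∧
      LinearMap.trace K M Ω = Module.finrank K I ∧
      ∀ m, Ω m ∈ Submodule.span K {⁅x, n⁆ | (x : L) (n : M)} := by
  classical
  set B : LinearMap.BilinForm K I := traceForm K I M
  have hsymm : B.IsSymm := ⟨traceForm_comm K I M⟩
  let b := Module.finBasis K I
  let d := dualBasis B hI b
  have hb (y : I) : y = ∑ j, B y (d j) • b j := by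
    have hdb : dualBasis B hI d = b := dualBasis_dualBasis hI hsymm b
    conv_lhs => rw [← (dualBasis B hI d).sum_repr y]
    simp only [dualBasis_repr_apply]
    rw [hdb]
  have hd (y : I) : y = ∑ j, B y (b j) • d j := by
    conv_lhs => rw [← d.sum_repr y]
    simp only [d, dualBasis_repr_apply]
  have hinv (x : L) (y z : I) : B ⁅x, y⁆ z = -B ⁅x, z⁆ y := by
    change traceForm K L M ⁅x, (y : L)⁆ z = -traceForm K L M ⁅x, (z : L)⁆ y
    rw [traceForm_apply_lie_apply', traceForm_comm]
  let φ : I →ₗ[K] Module.End K M := (toEnd K L M : L →ₗ[K] Module.End K M) ∘ₗ I.toSubmodule.subtype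
  have hφ (x : L) (y : I) :
      toEnd K L M x * φ y = φ ⁅x, y⁆ + φ y * toEnd K L M x := by
    ext m
    exact (leibniz_lie x (y : L) m)
  refine ⟨∑ i, φ (b i) * φ (d i), fun x ↦ ?_, ?_, fun m ↦ ?_⟩
  · have key : ∑ i, φ ⁅x, b i⁆ * φ (d i) + ∑ i, φ (b i) * φ ⁅x, d i⁆ = 0 := by
      have h₁ (i) : φ ⁅x, b i⁆ * φ (d i) = ∑ j, B ⁅x, b i⁆ (d j) • (φ (b j) * φ (d i)) := by
        conv_lhs => rw [hb ⁅x, b i⁆]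
        simp [Finset.sum_mul]
      have h₂ (i) : φ (b i) * φ ⁅x, d i⁆ = ∑ j, B ⁅x, d i⁆ (b j) • (φ (b i) * φ (d j)) := by
        conv_lhs => rw [hd ⁅x, d i⁆]
        simp [Finset.mul_sum]
      simp only [h₁, h₂]
      rw [Finset.sum_comm, ← Finset.sum_add_distrib]
      refine Finset.sum_eq_zero fun i _ ↦ ?_
      rw [← Finset.sum_add_distrib]
      refine Finset.sum_eq_zero fun j _ ↦ ?_
      rw [hinv, ← add_smul, neg_add_cancel, zero_smul]
    rw [commute_iff_lie_eq, Ring.lie_def, Finset.mul_sum, Finset.sum_mul, ← Finset.sum_sub_distrib,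
      ← key, ← Finset.sum_add_distrib]
    refine Finset.sum_congr rfl fun i _ ↦ ?_
    rw [← mul_assoc, hφ, add_mul, mul_assoc, hφ]
    noncomm_ring
  · have h_one (i) : LinearMap.trace K M (φ (b i) * φ (d i)) = 1 := by
      change B (b i) (d i) = 1
      rw [apply_dualBasis_right hI hsymm, if_pos rfl]
    simp [h_one]
  · rw [LinearMap.sum_apply]
    exact Submodule.sum_mem _ fun i _ ↦ Submodule.subset_span ⟨b i, φ (d i) m, rfl⟩

theorem LieAlgebra.IsKilling.lie_top_top {K L : Type*} [Field K] [LieRing L] [LieAlgebra K L]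
    [FiniteDimensional K L] [LieAlgebra.IsKilling K L] :
    ⁅(⊤ : LieIdeal K L), (⊤ : LieIdeal K L)⁆ = ⊤ := by
  suffices h : LieIdeal.killingCompl K L ⁅(⊤ : LieIdeal K L), (⊤ : LieIdeal K L)⁆ = ⊥ from
    eq_top_of_isCompl_bot (h ▸ LieIdeal.isCompl_killingCompl _)
  rw [eq_bot_iff]
  intro x hx
  rw [LieIdeal.mem_killingCompl] at hx
  have hxy (y : L) : ⁅x, y⁆ = 0 := by
    refine (killingForm_nondegenerate K L).1 _ fun z ↦ ?_
    rw [LieModule.traceForm_apply_lie_apply, LieModule.traceForm_comm]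
    exact hx _ (LieSubmodule.lie_mem_lie (LieSubmodule.mem_top y) (LieSubmodule.mem_top z))
  have : x ∈ LieAlgebra.center K L := fun y ↦ by rw [← lie_skew, hxy, neg_zero]
  simpa using this

/-- A module over a perfect Lie algebra on which the trace form vanishes is trivial. -/
theorem LieModule.isTrivial_of_traceForm_eq_zero {K L M : Type*} [Field K] [CharZero K]
    [LieRing L] [LieAlgebra K L]
    [AddCommGroup M] [Module K M] [LieRingModule L M] [LieModule K L M] [FiniteDimensional K M]
    (hL : ⁅(⊤ : LieIdeal K L), (⊤ : LieIdeal K L)⁆ = ⊤) (h : traceForm K L M = 0) :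
    LieModule.IsTrivial L M := by
  have hnil : LieModule.IsNilpotent L M := by
    have := isNilpotent_derivedSeries_of_traceForm_eq_zero h
    rw [isNilpotent_iff_forall' (R := K)] at this ⊢
    exact fun x ↦ this ⟨x, by simp [hL]⟩
  obtain ⟨k, hk⟩ := (LieModule.isNilpotent_iff K L M).mp hnil
  have hle : ⁅(⊤ : LieIdeal K L), (⊤ : LieSubmodule K L M)⁆ ≤
      ⁅(⊤ : LieIdeal K L), ⁅(⊤ : LieIdeal K L), (⊤ : LieSubmodule K L M)⁆⁆ := by
    rw [LieSubmodule.lie_le_iff]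
    intro x _ m _
    have hx : x ∈ (⁅(⊤ : LieIdeal K L), (⊤ : LieIdeal K L)⁆ : LieIdeal K L).toSubmodule := by
      simp [hL]
    rw [LieSubmodule.lieIdeal_oper_eq_linear_span'] at hx
    induction hx using Submodule.span_induction with
    | mem x hx =>
      obtain ⟨y, hy, z, hz, rfl⟩ := hx
      rw [lie_lie]
      exact sub_mem (LieSubmodule.lie_mem_lie hy (LieSubmodule.lie_mem_lie hz (by simp)))
        (LieSubmodule.lie_mem_lie hz (LieSubmodule.lie_mem_lie hy (by simp)))
    | zero => simp
    | add x y _ _ hx hy => rw [add_lie]; exact add_mem (hx (by simp)) (hy (by simp))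
    | smul c x _ hx => rw [smul_lie]; exact SMulMemClass.smul_mem c (hx (by simp))
  have hlcs (n : ℕ) : ⁅(⊤ : LieIdeal K L), (⊤ : LieSubmodule K L M)⁆ ≤
      lowerCentralSeries K L M n := by
    induction n with
    | zero => simp
    | succ n ih =>
      rw [lowerCentralSeries_succ]
      exact hle.trans (LieSubmodule.mono_lie_right _ ih)
  refine ⟨fun x m ↦ ?_⟩
  have := hlcs k (LieSubmodule.lie_mem_lie (LieSubmodule.mem_top x) (LieSubmodule.mem_top m))
  simpa [hk] using this

/-- A finite-dimensional module over a semisimple Lie algebra is spanned by its invariants together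
with all brackets. -/
theorem LieModule.eq_zero_of_forall_lie_eq_zero {K L : Type*} [Field K] [CharZero K]
    [LieRing L] [LieAlgebra K L] [FiniteDimensional K L] [LieAlgebra.IsKilling K L]
    {M : Type*} [AddCommGroup M] [Module K M] [LieRingModule L M] [LieModule K L M]
    [FiniteDimensional K M] (f : M →ₗ[K] K) (hf : ∀ (x : L) (m : M), f ⁅x, m⁆ = 0)
    (hf' : ∀ m ∈ maxTrivSubmodule K L M, f m = 0) : f = 0 := by
  induction hn : Module.finrank K M using Nat.strong_induction_on generalizing M with
  | _ n ih =>
  by_cases htf : traceForm K L M = 0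
  · have := isTrivial_of_traceForm_eq_zero LieAlgebra.IsKilling.lie_top_top htf
    ext m
    exact hf' m fun x ↦ trivial_lie_zero L M x m
  let R : LieIdeal K L :=
    LieAlgebra.InvariantForm.orthogonal (traceForm K L M) (traceForm_lieInvariant K L M) ⊤
  have hR (x : L) : x ∈ R ↔ ∀ y, traceForm K L M x y = 0 := by
    simp [R, LieAlgebra.InvariantForm.mem_orthogonal, traceForm_comm K L M x]
  let J := LieIdeal.killingCompl K L R
  have hRJ : IsCompl R J := R.isCompl_killingCompl
  have hJ : J ≠ ⊥ := by
    intro h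
    have hR_top : R = ⊤ := eq_top_of_isCompl_bot (h ▸ hRJ)
    apply htf
    ext x y
    exact (hR x).mp (by simp [hR_top]) y
  have hnd : LinearMap.BilinForm.Nondegenerate (traceForm K J M) := by
    rw [LinearMap.BilinForm.Nondegenerate,
      (traceForm_isSymm K J M).isRefl.nondegenerate_iff_separatingLeft]
    intro x hx
    have hxR : (x : L) ∈ R := by
      rw [hR]
      intro y
      have hy : y ∈ R ⊔ J := by simp [hRJ.sup_eq_top]
      obtain ⟨r, hr, j, hj, rfl⟩ := (LieSubmodule.mem_sup _ _ _).mp hy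
      rw [map_add, traceForm_comm K L M x r, (hR r).mp hr, zero_add]
      exact hx ⟨j, hj⟩
    have : (x : L) ∈ R ⊓ J := ⟨hxR, x.2⟩
    rw [hRJ.inf_eq_bot] at this
    exact Subtype.ext (by simpa using this)
  obtain ⟨Ω, hcomm, htr, hrange⟩ := exists_commute_trace_eq_finrank J hnd
  have hΩ : ¬ _root_.IsNilpotent Ω := by
    intro h
    have := (LinearMap.isNilpotent_trace_of_isNilpotent h).eq_zero
    rw [htr, Nat.cast_eq_zero, Module.finrank_zero_iff] at this
    exact hJ ((LieSubmodule.toSubmodule_eq_bot J).mp ((Submodule.subsingleton_iff_eq_bot).mp this))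
  have hfΩ (m : M) : f (Ω m) = 0 := by
    have : Submodule.span K {⁅x, n⁆ | (x : L) (n : M)} ≤ LinearMap.ker f := by
      rw [Submodule.span_le]
      rintro _ ⟨x, m, rfl⟩
      exact hf x m
    exact this (hrange m)
  obtain ⟨k, hk⟩ := ((Filter.eventually_ge_atTop 1).and
    Ω.eventually_isCompl_ker_pow_range_pow).exists
  let N : LieSubmodule K L M :=
    { LinearMap.ker (Ω ^ k) with
      lie_mem := fun {x m} hm ↦ by
        have := LinearMap.congr_fun ((hcomm x).pow_right k).eq m
        change (Ω ^ k) ⁅x, m⁆ = 0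
        have h₀ : (Ω ^ k) m = 0 := hm
        exact this.symm.trans (by simp [h₀]) }
  have hN : Module.finrank K N < n := by
    rw [← hn]
    refine Submodule.finrank_lt (s := N.toSubmodule) fun h ↦ hΩ ⟨k, ?_⟩
    exact LinearMap.ker_eq_top.mp h
  have hfN : f ∘ₗ N.toSubmodule.subtype = 0 :=
    ih _ hN (M := N) _ (fun x m ↦ hf x m)
      (fun m hm ↦ hf' m fun x ↦ congrArg Subtype.val (hm x)) rfl
  ext m
  have hm : m ∈ LinearMap.ker (Ω ^ k) ⊔ LinearMap.range (Ω ^ k) := by simp [hk.2.sup_eq_top]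
  obtain ⟨p, hp, _, ⟨q, rfl⟩, rfl⟩ := Submodule.mem_sup.mp hm
  obtain ⟨l, rfl⟩ := Nat.exists_eq_add_of_le' hk.1
  have : f p = 0 := LinearMap.congr_fun hfN ⟨p, hp⟩
  simp [this, pow_succ', hfΩ]

theorem stmt4 {K L : Type*} [Field K] [CharZero K] [LieRing L] [LieAlgebra K L]
    [FiniteDimensional K L]
    (hk : (killingForm K L).Nondegenerate)
    (s : LieSubalgebra K L) [LieAlgebra.IsSemisimple K s] :
    ∀ x : L, (∀ z ∈ s, ⁅x, z⁆ = 0) →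
      (∀ y : L, (∀ z ∈ s, ⁅y, z⁆ = 0) → killingForm K L x y = 0) → x = 0 := by
  intro x hx hxy
  have h : killingForm K L x = 0 := by
    refine LieModule.eq_zero_of_forall_lie_eq_zero (L := s) _ (fun z m ↦ ?_) fun y hy ↦ ?_
    · change killingForm K L x ⁅(z : L), m⁆ = 0
      rw [← LieModule.traceForm_apply_lie_apply, hx z z.2, map_zero, LinearMap.zero_apply]
    · refine hxy y fun z hz ↦ ?_
      rw [← lie_skew, neg_eq_zero]
      exact hy ⟨z, hz⟩
  exact hk.1 x fun y ↦ by rw [h, LinearMap.zero_apply]
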